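/- arXiv:1808.01889 — 6 statements merged into one kernel-verified Lean document; each statement's English description precedes it below -/
import Mathlib

section
/- Let S be a Stäckel matrix on ℝ^N with entries S(q)_{r,j} = σ_{r,j}(q_r), let v_1,…,v_N : ℝ → ℝ, let c ∈ ℝ^N, and for each i let W_i : ℝ → ℝ be differentiable with (W_i'(t))² + v_i(t) = 2 Σ_j σ_{i,j}(t) c_j for all t ∈ ℝ. Define H_i(q) = ½((W_i'(q_i))² + v_i(q_i)). Then for every q ∈ ℝ^N and every index a ∈ Fin N: Σ_i (S^{-1}(q))_{a,i} H_i(q) = c_a. In particular, setting g^{ii}(q) = (S^{-1}(q))_{1,i} and V(q) = Σ_i v_i(q_i) g^{ii}(q), the additively separated function W(q) = Σ_i W_i(q_i) satisfies the Hamilton–Jacobi equation ½( Σ_i g^{ii}(q) (∂_i W(q))² + V(q) ) = c_1 for all q. -/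
open scoped BigOperators

/-- Applying `A⁻¹` to `A c`, written in coordinates, recovers the vector `c`. -/
theorem sum_inv_mul_sum {n R : Type*} [Fintype n] [DecidableEq n] [CommRing R]
    {A : Matrix n n R} (hA : IsUnit A.det) (c : n → R) (a : n) :
    ∑ i, A⁻¹ a i * ∑ j, A i j * c j = c a := by
  have h : A⁻¹.mulVec (A.mulVec c) = c := by
    rw [Matrix.mulVec_mulVec, Matrix.nonsing_inv_mul A hA, Matrix.one_mulVec]
  exact congrFun h a

/-- The partial derivatives of an additively separated function. -/
theorem fderiv_sum_separated_single {n : Type*} [Fintype n] [DecidableEq n] {W : n → ℝ → ℝ}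
    {q : n → ℝ} (hW : ∀ k, DifferentiableAt ℝ (W k) (q k)) (i : n) :
    fderiv ℝ (fun q' : n → ℝ => ∑ k, W k (q' k)) q (Pi.single i 1) = deriv (W i) (q i) := by
  have h : HasFDerivAt (fun q' : n → ℝ => ∑ k, W k (q' k))
      (∑ k, deriv (W k) (q k) • ContinuousLinearMap.proj (R := ℝ) (φ := fun _ : n => ℝ) k) q :=
    HasFDerivAt.fun_sum fun k _ =>
      (hW k).hasDerivAt.comp_hasFDerivAt q (hasFDerivAt_apply k q)
  rw [h.fderiv]
  simp [Pi.single_apply]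

/-- Separated equations of a Stäckel system: if each `W_i`
solves the one-dimensional separated equation `(W_i')² + v_i = 2 ∑_j σ_{i,j} c_j`,
then the Hamiltonians `H_i(q) = ½((W_i'(q_i))² + v_i(q_i))` satisfy
`∑ i (S⁻¹(q))_{a,i} H_i(q) = c_a`, and the additively separated function
`W(q) = ∑ i W_i(q_i)` solves the Hamilton–Jacobi equation
`½(∑ i g^{ii}(q) (∂_i W(q))² + V(q)) = c_1`, where `g^{ii} = (S⁻¹)_{1,i}` and
`V(q) = ∑ i v_i(q_i) g^{ii}(q)`. -/
theorem stmt_1 (N : ℕ) [NeZero N] (S : (Fin N → ℝ) → Matrix (Fin N) (Fin N) ℝ)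
    (σ : Fin N → Fin N → ℝ → ℝ)
    (hσ : ∀ r j, Differentiable ℝ (σ r j))
    (hS : ∀ q r j, S q r j = σ r j (q r))
    (hinv : ∀ q, IsUnit (S q).det)
    (v : Fin N → ℝ → ℝ) (c : Fin N → ℝ) (W : Fin N → ℝ → ℝ)
    (hW : ∀ i, Differentiable ℝ (W i))
    (hsep : ∀ i, ∀ t : ℝ, (deriv (W i) t) ^ 2 + v i t = 2 * ∑ j : Fin N, σ i j t * c j)
    (H : Fin N → (Fin N → ℝ) → ℝ)
    (hH : ∀ i q, H i q = (1 / 2) * ((deriv (W i) (q i)) ^ 2 + v i (q i))) :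
    (∀ q : Fin N → ℝ, ∀ a : Fin N, ∑ i : Fin N, (S q)⁻¹ a i * H i q = c a) ∧
    (∀ q : Fin N → ℝ,
      (1 / 2) * ((∑ i : Fin N,
            (S q)⁻¹ 0 i *
              (fderiv ℝ (fun q' : Fin N → ℝ => ∑ k : Fin N, W k (q' k)) q (Pi.single i 1)) ^ 2)
          + ∑ i : Fin N, v i (q i) * (S q)⁻¹ 0 i) = c 0) := by
  have key : ∀ q : Fin N → ℝ, ∀ a : Fin N, ∑ i : Fin N, (S q)⁻¹ a i * H i q = c a := by
    intro q a
    rw [← sum_inv_mul_sum (hinv q) c a]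
    refine Finset.sum_congr rfl fun i _ => ?_
    simp only [hH, hsep, hS]
    ring
  refine ⟨key, fun q => ?_⟩
  rw [← key q 0, ← Finset.sum_add_distrib, Finset.mul_sum]
  refine Finset.sum_congr rfl fun i _ => ?_
  rw [fderiv_sum_separated_single (fun k => hW k (q k)) i, hH]
  ring
end

section
/- Let S be a Stäckel matrix on ℝ^N with entries S(q)_{r,j} = σ_{r,j}(q_r), σ_{r,j} differentiable, and let v_1,…,v_N : ℝ → ℝ be differentiable. Define H_r : ℝ^N × ℝ^N → ℝ by H_r(q,p) = ½(p_r² + v_r(q_r)) and, for each a ∈ Fin N, K_a(q,p) = Σ_r (S^{-1}(q))_{a,r} H_r(q,p). Then {K_a, K_b} = 0 for all a, b ∈ Fin N; in particular every K_a Poisson-commutes with the Hamiltonian H = K_1 = Σ_r (S^{-1})_{1,r} H_r. -/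
open scoped BigOperators

/-- The canonical Poisson bracket of two functions on phase space
`ℝ^N × ℝ^N` (variables `(q,p)`):
`{F,G} = ∑ i (∂F/∂p_i · ∂G/∂q_i − ∂F/∂q_i · ∂G/∂p_i)`. -/
noncomputable def poissonBracket {N : ℕ}
    (F G : (Fin N → ℝ) × (Fin N → ℝ) → ℝ) :
    (Fin N → ℝ) × (Fin N → ℝ) → ℝ :=
  fun x => ∑ i : Fin N,
    (fderiv ℝ F x (0, Pi.single i 1) * fderiv ℝ G x (Pi.single i 1, 0)
      - fderiv ℝ F x (Pi.single i 1, 0) * fderiv ℝ G x (0, Pi.single i 1))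

open scoped Matrix

/-- The entries of the pointwise inverse of a matrix with differentiable entries are
differentiable. -/
theorem Differentiable.matrix_inv_apply {E n : Type*} [NormedAddCommGroup E] [NormedSpace ℝ E]
    [Fintype n] [DecidableEq n] {A : E → Matrix n n ℝ}
    (hA : ∀ i j, Differentiable ℝ fun x => A x i j) (hdet : ∀ x, IsUnit (A x).det) (i j : n) :
    Differentiable ℝ fun x => (A x)⁻¹ i j := by
  have det_differentiable (B : E → Matrix n n ℝ)
      (hB : ∀ i j, Differentiable ℝ fun x => B x i j) : Differentiable ℝ fun x => (B x).det := by
    simp only [Matrix.det_apply']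
    fun_prop
  have hadj : Differentiable ℝ fun x => (A x).adjugate i j := by
    simp only [Matrix.adjugate_apply]
    refine det_differentiable _ fun k l => ?_
    by_cases hk : k = j
    · subst hk
      simp
    · simpa [Matrix.updateRow_apply, hk] using hA k l
  simp only [Matrix.inv_def, Matrix.smul_apply, smul_eq_mul, Ring.inverse_eq_inv']
  exact ((det_differentiable A hA).inv fun x => (hdet x).ne_zero).mul hadj

/-- If `A(x) K(x) = H(x)` and along the direction `d` only the `i`-th row of `A` and the `i`-th
entry of `H` vary, then the derivative of `K` along `d` is a multiple of the `i`-th column of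
`A⁻¹`. -/
theorem exists_fderiv_apply_eq_inv_mul {E n : Type*} [NormedAddCommGroup E] [NormedSpace ℝ E]
    [Fintype n] [DecidableEq n] {A : E → Matrix n n ℝ} {K H : n → E → ℝ}
    (hK : ∀ j, Differentiable ℝ (K j)) (hAK : ∀ x r, ∑ j, A x r j * K j x = H r x)
    {x d : E} (hdet : IsUnit (A x).det) {i : n}
    (hAd : ∀ r, r ≠ i → ∀ (t : ℝ) j, A (x + t • d) r j = A x r j)
    (hHd : ∀ r, r ≠ i → ∀ t : ℝ, H r (x + t • d) = H r x) :
    ∃ c : ℝ, ∀ a, fderiv ℝ (K a) x d = (A x)⁻¹ a i * c := by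
  set D : n → ℝ := fun j => fderiv ℝ (K j) x d with hD
  have hrow (r : n) (hr : r ≠ i) : (A x *ᵥ D) r = 0 := by
    have h₁ : HasDerivAt (fun t : ℝ => ∑ j, A x r j * K j (x + t • d)) ((A x *ᵥ D) r) 0 :=
      HasDerivAt.fun_sum fun j _ =>
        HasDerivAt.const_mul _ ((hK j x).hasFDerivAt.hasLineDerivAt d)
    have h₂ : (fun t : ℝ => ∑ j, A x r j * K j (x + t • d)) = fun _ => H r x := by
      funext t
      rw [← hHd r hr t, ← hAK]
      simp only [hAd r hr]
    rw [h₂] at h₁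
    exact h₁.unique (hasDerivAt_const _ _)
  have hsingle : A x *ᵥ D = Pi.single i ((A x *ᵥ D) i) := by
    funext r
    by_cases hr : r = i
    · subst hr
      simp
    · rw [hrow r hr, Pi.single_eq_of_ne hr]
  refine ⟨(A x *ᵥ D) i, fun a => ?_⟩
  have hinv : (A x)⁻¹ *ᵥ (A x *ᵥ D) = D := by
    rw [Matrix.mulVec_mulVec, Matrix.nonsing_inv_mul _ hdet, Matrix.one_mulVec]
  rw [hsingle] at hinv
  simpa [mul_comm] using (congrFun hinv a).symm

/-- For a Stäckel matrix `S` on `ℝ^N` and one-dimensional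
Hamiltonians `H_r(q,p) = ½(p_r² + v_r(q_r))`, the functions
`K_a = ∑ r (S⁻¹)_{a,r} H_r` are pairwise in Poisson involution; in particular
each `K_a` Poisson-commutes with `H = K_1 = ∑ r (S⁻¹)_{1,r} H_r`. -/
theorem stmt_2 (N : ℕ) (S : (Fin N → ℝ) → Matrix (Fin N) (Fin N) ℝ)
    (σ : Fin N → Fin N → ℝ → ℝ)
    (hσ : ∀ r j, Differentiable ℝ (σ r j))
    (hS : ∀ q r j, S q r j = σ r j (q r))
    (hinv : ∀ q, IsUnit (S q).det)
    (v : Fin N → ℝ → ℝ) (hv : ∀ r, Differentiable ℝ (v r))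
    (H : Fin N → (Fin N → ℝ) × (Fin N → ℝ) → ℝ)
    (hH : ∀ r x, H r x = (1 / 2) * ((x.2 r) ^ 2 + v r (x.1 r)))
    (K : Fin N → (Fin N → ℝ) × (Fin N → ℝ) → ℝ)
    (hK : ∀ a x, K a x = ∑ r : Fin N, (S x.1)⁻¹ a r * H r x) :
    ∀ a b : Fin N, poissonBracket (K a) (K b) = 0 := by
  have hS_eq (r j : Fin N) :
      (fun x : (Fin N → ℝ) × (Fin N → ℝ) => S x.1 r j) = fun x => σ r j (x.1 r) :=
    funext fun x => hS x.1 r j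
  have hKdiff (a : Fin N) : Differentiable ℝ (K a) := by
    have hinv_diff (r : Fin N) :
        Differentiable ℝ fun x : (Fin N → ℝ) × (Fin N → ℝ) => (S x.1)⁻¹ a r :=
      Differentiable.matrix_inv_apply (A := fun x : (Fin N → ℝ) × (Fin N → ℝ) => S x.1)
        (fun r j => by rw [hS_eq]; fun_prop) (fun x => hinv x.1) a r
    rw [funext (hK a)]
    refine Differentiable.fun_sum fun r _ => (hinv_diff r).mul ?_
    rw [funext (hH r)]
    fun_prop
  have hSK (x : (Fin N → ℝ) × (Fin N → ℝ)) (r : Fin N) : ∑ j, S x.1 r j * K j x = H r x := by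
    have hKx : (fun j => K j x) = (S x.1)⁻¹ *ᵥ fun r => H r x := funext fun j => hK j x
    have h : (S x.1 *ᵥ fun j => K j x) = fun r => H r x := by
      rw [hKx, Matrix.mulVec_mulVec, Matrix.mul_nonsing_inv _ (hinv x.1), Matrix.one_mulVec]
    exact congrFun h r
  have hdir (x d : (Fin N → ℝ) × (Fin N → ℝ)) (i : Fin N)
      (hd : ∀ r, r ≠ i → d.1 r = 0 ∧ d.2 r = 0) :
      ∃ c : ℝ, ∀ a, fderiv ℝ (K a) x d = (S x.1)⁻¹ a i * c :=
    exists_fderiv_apply_eq_inv_mul hKdiff hSK (hinv x.1)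
      (fun r hr t j => by simp [hS, (hd r hr).1])
      (fun r hr t => by simp [hH, (hd r hr).1, (hd r hr).2])
  intro a b
  funext x
  refine Finset.sum_eq_zero fun i _ => ?_
  obtain ⟨c, hc⟩ := hdir x (0, Pi.single i 1) i fun r hr => by simp [hr]
  obtain ⟨e, he⟩ := hdir x (Pi.single i 1, 0) i fun r hr => by simp [hr]
  rw [hc, hc, he, he]
  ring
end

section
/- Fix a block assignment β : Fin N → Fin n, let S be a block-Stäckel matrix with differentiable entries, and for each r ∈ Fin n let H_r : ℝ^N × ℝ^N → ℝ be differentiable and depend only on the r-block variables (q_i, p_i) with β(i) = r. Define K_a(q,p) = Σ_r (S^{-1}(q))_{a,r} H_r(q,p) for a ∈ Fin n. Then the functions K_a are pairwise in Poisson involution: {K_a, K_b} = 0 for all a, b ∈ Fin n; in particular every K_a Poisson-commutes with H = K_1. -/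
open scoped BigOperators

section MatrixCalculus

variable {E m : Type*} [NormedAddCommGroup E] [NormedSpace ℝ E] [Fintype m] [DecidableEq m]

theorem differentiable_matrix_det {A : E → Matrix m m ℝ}
    (hA : ∀ i j, Differentiable ℝ fun x => A x i j) :
    Differentiable ℝ fun x => (A x).det := by
  simp only [Matrix.det_apply']
  fun_prop

theorem differentiable_matrix_inv_apply {A : E → Matrix m m ℝ}
    (hA : ∀ i j, Differentiable ℝ fun x => A x i j) (hdet : ∀ x, IsUnit (A x).det) (i j : m) :
    Differentiable ℝ fun x => (A x)⁻¹ i j := by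
  have hadj : Differentiable ℝ fun x => (A x).adjugate i j := by
    simp only [Matrix.adjugate_apply]
    refine differentiable_matrix_det fun k l => ?_
    by_cases hk : k = j
    · simp [Matrix.updateRow_apply, hk]
    · simpa [Matrix.updateRow_apply, hk] using hA k l
  simp only [Matrix.inv_def, Ring.inverse_eq_inv', Matrix.smul_apply, smul_eq_mul]
  exact ((differentiable_matrix_det hA).inv fun x => (hdet x).ne_zero).mul hadj

/-- If `A K = H` and, in the direction `v`, the derivatives of `H r` and of the `r`-th row of `A`
vanish for all `r ≠ s`, then the derivative of `K` along `v` is a multiple of the `s`-th column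
of `A⁻¹`. -/
theorem fderiv_eq_inv_apply_mul {A : E → Matrix m m ℝ} {H K : m → E → ℝ} {x v : E} {s : m}
    (hA : ∀ i j, DifferentiableAt ℝ (fun y => A y i j) x) (hdet : IsUnit (A x).det)
    (hK : ∀ a, DifferentiableAt ℝ (K a) x) (hAK : ∀ r y, ∑ a, A y r a * K a y = H r y)
    (hAv : ∀ r, r ≠ s → ∀ j, fderiv ℝ (fun y => A y r j) x v = 0)
    (hHv : ∀ r, r ≠ s → fderiv ℝ (H r) x v = 0) :
    ∃ c : ℝ, ∀ a, fderiv ℝ (K a) x v = (A x)⁻¹ a s * c := by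
  have hlin (r : m) : ∑ a, A x r a * fderiv ℝ (K a) x v
      = fderiv ℝ (H r) x v - ∑ a, fderiv ℝ (fun y => A y r a) x v * K a x := by
    have hd := HasFDerivAt.fun_sum (u := Finset.univ)
      fun a _ => (hA r a).hasFDerivAt.mul (hK a).hasFDerivAt
    have heq : H r = fun y => ∑ a, A y r a * K a y := funext fun y => (hAK r y).symm
    rw [heq, HasFDerivAt.fderiv (f := fun y => ∑ a, A y r a * K a y) hd]
    simp [Finset.sum_add_distrib, mul_comm]
  set c : ℝ := fderiv ℝ (H s) x v - ∑ a, fderiv ℝ (fun y => A y s a) x v * K a x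
  have hvec : Matrix.mulVec (A x) (fun a => fderiv ℝ (K a) x v) = Pi.single s c := by
    ext r
    rw [Matrix.mulVec, dotProduct, hlin r]
    by_cases hr : r = s
    · subst hr
      simp [c]
    · simp [hr, hHv r hr, hAv r hr]
  refine ⟨c, fun a => ?_⟩
  have hsolve := congrFun (congrArg (Matrix.mulVec (A x)⁻¹) hvec) a
  rw [Matrix.mulVec_mulVec, Matrix.nonsing_inv_mul _ hdet, Matrix.one_mulVec] at hsolve
  simpa [Matrix.mulVec_single] using hsolve

end MatrixCalculus

/-- Given a block assignment `β : Fin N → Fin n`, a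
block-Stäckel matrix `S` (differentiable, invertible, each entry of row `r`
depending only on the `r`-block coordinates), and for each `r` a differentiable
Hamiltonian `H_r` depending only on the `r`-block variables `(q_i, p_i)` with
`β i = r`, the functions `K_a = ∑ r (S⁻¹)_{a,r} H_r` are pairwise in Poisson
involution; in particular each `K_a` Poisson-commutes with `H = K_1`. -/
theorem stmt_3 (N n : ℕ) (β : Fin N → Fin n) (hβ : Function.Surjective β)
    (S : (Fin N → ℝ) → Matrix (Fin n) (Fin n) ℝ)
    (hSdiff : ∀ r j : Fin n, Differentiable ℝ (fun q => S q r j))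
    (hSinv : ∀ q, IsUnit (S q).det)
    (hSblock : ∀ (r j : Fin n) (i : Fin N), β i ≠ r →
      ∀ q : Fin N → ℝ, fderiv ℝ (fun q' => S q' r j) q (Pi.single i 1) = 0)
    (H : Fin n → (Fin N → ℝ) × (Fin N → ℝ) → ℝ)
    (hHdiff : ∀ r, Differentiable ℝ (H r))
    (hHblock : ∀ (r : Fin n) (i : Fin N), β i ≠ r →
      ∀ x : (Fin N → ℝ) × (Fin N → ℝ),
        fderiv ℝ (H r) x (Pi.single i 1, 0) = 0 ∧
        fderiv ℝ (H r) x (0, Pi.single i 1) = 0)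
    (K : Fin n → (Fin N → ℝ) × (Fin N → ℝ) → ℝ)
    (hK : ∀ a x, K a x = ∑ r : Fin n, (S x.1)⁻¹ a r * H r x) :
    ∀ a b : Fin n, poissonBracket (K a) (K b) = 0 := by
  intro a b
  have hA (r j : Fin n) :
      Differentiable ℝ fun x : (Fin N → ℝ) × (Fin N → ℝ) => S x.1 r j :=
    (hSdiff r j).comp differentiable_fst
  have hKdiff (c : Fin n) : Differentiable ℝ (K c) := by
    rw [show K c = fun x => ∑ r, (S x.1)⁻¹ c r * H r x from funext (hK c)]
    exact Differentiable.fun_sum fun r _ =>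
      (differentiable_matrix_inv_apply hA (fun x => hSinv x.1) c r).mul (hHdiff r)
  have hAK (r : Fin n) (x : (Fin N → ℝ) × (Fin N → ℝ)) :
      ∑ c, S x.1 r c * K c x = H r x := by
    have hvec : (fun c => K c x) = Matrix.mulVec (S x.1)⁻¹ (fun r => H r x) :=
      funext fun c => hK c x
    change Matrix.mulVec (S x.1) (fun c => K c x) r = H r x
    rw [hvec, Matrix.mulVec_mulVec, Matrix.mul_nonsing_inv _ (hSinv x.1), Matrix.one_mulVec]
  have hSfst (r j : Fin n) (x v : (Fin N → ℝ) × (Fin N → ℝ)) :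
      fderiv ℝ (fun y : (Fin N → ℝ) × (Fin N → ℝ) => S y.1 r j) x v
        = fderiv ℝ (fun q => S q r j) x.1 v.1 := by
    have hd := (hSdiff r j x.1).hasFDerivAt.comp x hasFDerivAt_fst
    rw [HasFDerivAt.fderiv (f := fun y : (Fin N → ℝ) × (Fin N → ℝ) => S y.1 r j) hd]
    rfl
  funext x
  refine Finset.sum_eq_zero fun i _ => ?_
  obtain ⟨c, hc⟩ := fderiv_eq_inv_apply_mul (s := β i) (v := (Pi.single i 1, 0))
    (fun r j => hA r j x) (hSinv x.1) (fun c => hKdiff c x) hAK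
    (fun r hr j => (hSfst r j x _).trans (hSblock r j i hr.symm x.1))
    (fun r hr => (hHblock r i hr.symm x).1)
  obtain ⟨d, hd⟩ := fderiv_eq_inv_apply_mul (s := β i) (v := (0, Pi.single i 1))
    (fun r j => hA r j x) (hSinv x.1) (fun c => hKdiff c x) hAK
    (fun r _ j => (hSfst r j x _).trans (map_zero _))
    (fun r hr => (hHblock r i hr.symm x).2)
  rw [hc a, hc b, hd a, hd b]
  ring
end

section
/- Fix a block assignment β : Fin N → Fin n and a block-Stäckel matrix S with differentiable entries. For each r ∈ Fin n let H_r(q,p) = ½ Σ_{β(i)=β(j)=r} g_r^{ij}(q) p_i p_j + V_r(q), where the functions g_r^{ij} and V_r are differentiable and depend only on the r-block coordinates. Set α^r = (S^{-1})_{1,r} and H = Σ_r α^r H_r. Let (q(t), p(t)), t ∈ I, satisfy Hamilton's equations for H, and suppose c ∈ ℝ^n is such that Σ_r (S^{-1}(q(t)))_{a,r} H_r(q(t),p(t)) = c_a for all t ∈ I and all a ∈ Fin n. Define H̃_r(q,p) = H_r(q,p) − Σ_a c_a S(q)_{r,a}. Then for every i ∈ Fin N with β(i) = r and every t ∈ I: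 dq_i/dt = α^r(q(t)) · ∂H̃_r/∂p_i (q(t),p(t)) and dp_i/dt = −α^r(q(t)) · ∂H̃_r/∂q_i (q(t),p(t)); i.e., the r-block component of the Hamiltonian vector field of H along the orbit equals α^r times the Hamiltonian vector field of H̃_r. -/
open scoped BigOperators

/-- The determinant of a matrix with differentiable entries is differentiable. -/
theorem differentiableAt_det {E ι : Type*} [NormedAddCommGroup E] [NormedSpace ℝ E]
    [Fintype ι] [DecidableEq ι] {A : E → Matrix ι ι ℝ} {x : E}
    (hA : ∀ i j, DifferentiableAt ℝ (fun y => A y i j) x) :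
    DifferentiableAt ℝ (fun y => (A y).det) x := by
  simp only [Matrix.det_apply']
  refine DifferentiableAt.fun_sum fun σ _ => DifferentiableAt.const_mul ?_ _
  exact (HasFDerivAt.finsetProd fun i _ => (hA (σ i) i).hasFDerivAt).differentiableAt

/-- The entries of the inverse of an invertible matrix with differentiable entries are
differentiable. -/
theorem differentiableAt_matrix_inv_apply {E ι : Type*} [NormedAddCommGroup E] [NormedSpace ℝ E]
    [Fintype ι] [DecidableEq ι] {A : E → Matrix ι ι ℝ} {x : E}
    (hA : ∀ i j, DifferentiableAt ℝ (fun y => A y i j) x) (hx : IsUnit (A x).det) (i j : ι) :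
    DifferentiableAt ℝ (fun y => (A y)⁻¹ i j) x := by
  simp only [Matrix.inv_def, Matrix.smul_apply, smul_eq_mul, Ring.inverse_eq_inv',
    Matrix.adjugate_apply]
  refine ((differentiableAt_det hA).fun_inv hx.ne_zero).mul (differentiableAt_det fun k l => ?_)
  by_cases hk : k = j
  · subst hk
    simp
  · simpa [Matrix.updateRow_ne hk] using hA k l

/-- If every `f r` vanishes at `x`, the derivative of `∑ r, a r * f r` at `x` only involves the
derivatives of the `f r`. -/
theorem fderiv_sum_mul_of_eq_zero {E ι : Type*} [NormedAddCommGroup E] [NormedSpace ℝ E]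
    [Fintype ι] {a f : ι → E → ℝ} {x : E} (ha : ∀ r, DifferentiableAt ℝ (a r) x)
    (hf : ∀ r, DifferentiableAt ℝ (f r) x) (h0 : ∀ r, f r x = 0) (v : E) :
    fderiv ℝ (fun y => ∑ r, a r y * f r y) x v = ∑ r, a r x * fderiv ℝ (f r) x v := by
  have h := HasFDerivAt.fun_sum (u := Finset.univ) fun r _ =>
    (ha r).hasFDerivAt.mul (hf r).hasFDerivAt
  simpa [h0] using congrArg (fun L => L v) h.fderiv

/-- A function of the first variable whose derivative at `x.1` vanishes in the direction `v.1`
has zero line derivative at `x` in the direction `v`. -/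
theorem hasLineDerivAt_comp_fst_zero {E F : Type*} [NormedAddCommGroup E] [NormedSpace ℝ E]
    [NormedAddCommGroup F] [NormedSpace ℝ F] {f : E → ℝ} {x v : E × F}
    (hf : DifferentiableAt ℝ f x.1) (hv : fderiv ℝ f x.1 v.1 = 0) :
    HasLineDerivAt ℝ (fun y : E × F => f y.1) 0 x v := by
  have h := (hf.hasFDerivAt.comp x hasFDerivAt_fst).hasLineDerivAt v
  simpa [hv, Function.comp_def] using h

/-- Block-separation of the dynamics: along an orbit of the
block-twisted Hamiltonian `H = ∑ r α^r H_r` (with `α^r = (S⁻¹)_{1,r}` for a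
block-Stäckel matrix `S`, and each `H_r = ½ ∑_{β(i)=β(j)=r} g_r^{ij} p_i p_j + V_r`
depending only on the `r`-block) on which the block first integrals take the
constant values `c_a`, the `r`-block component of `X_H` equals `α^r` times the
Hamiltonian vector field of `H̃_r = H_r − ∑_a c_a S_{r,a}`. -/
theorem stmt_7 (N n : ℕ) [NeZero n] (β : Fin N → Fin n) (hβ : Function.Surjective β)
    (S : (Fin N → ℝ) → Matrix (Fin n) (Fin n) ℝ)
    (hSdiff : ∀ r j : Fin n, Differentiable ℝ (fun q => S q r j))
    (hSinv : ∀ q, IsUnit (S q).det)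
    (hSblock : ∀ (r j : Fin n) (i : Fin N), β i ≠ r →
      ∀ q : Fin N → ℝ, fderiv ℝ (fun q' => S q' r j) q (Pi.single i 1) = 0)
    (g : Fin n → (Fin N → ℝ) → Fin N → Fin N → ℝ)
    (V : Fin n → (Fin N → ℝ) → ℝ)
    (hgdiff : ∀ r i j, Differentiable ℝ (fun q => g r q i j))
    (hVdiff : ∀ r, Differentiable ℝ (V r))
    (hgblock : ∀ (r : Fin n) (i j : Fin N) (k : Fin N), β k ≠ r →
      ∀ q : Fin N → ℝ, fderiv ℝ (fun q' => g r q' i j) q (Pi.single k 1) = 0)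
    (hVblock : ∀ (r : Fin n) (k : Fin N), β k ≠ r →
      ∀ q : Fin N → ℝ, fderiv ℝ (V r) q (Pi.single k 1) = 0)
    (H : Fin n → (Fin N → ℝ) × (Fin N → ℝ) → ℝ)
    (hHr : ∀ r x, H r x =
      (1 / 2) * (∑ i ∈ Finset.univ.filter (fun i => β i = r),
          ∑ j ∈ Finset.univ.filter (fun j => β j = r), g r x.1 i j * x.2 i * x.2 j)
        + V r x.1)
    (Htot : (Fin N → ℝ) × (Fin N → ℝ) → ℝ)
    (hHtot : ∀ x, Htot x = ∑ r : Fin n, (S x.1)⁻¹ 0 r * H r x)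
    (I : Set ℝ) (hI : I.OrdConnected)
    (q p : ℝ → Fin N → ℝ)
    (hq : ∀ t ∈ I, ∀ i, DifferentiableAt ℝ (fun s => q s i) t)
    (hp : ∀ t ∈ I, ∀ i, DifferentiableAt ℝ (fun s => p s i) t)
    (hHam : ∀ t ∈ I, ∀ i : Fin N,
      deriv (fun s => q s i) t = fderiv ℝ Htot (q t, p t) (0, Pi.single i 1) ∧
      deriv (fun s => p s i) t = -fderiv ℝ Htot (q t, p t) (Pi.single i 1, 0))
    (c : Fin n → ℝ)
    (hc : ∀ t ∈ I, ∀ a : Fin n,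
      ∑ r : Fin n, (S (q t))⁻¹ a r * H r (q t, p t) = c a) :
    ∀ (i : Fin N), ∀ t ∈ I,
      deriv (fun s => q s i) t
        = (S (q t))⁻¹ 0 (β i) *
            fderiv ℝ (fun x : (Fin N → ℝ) × (Fin N → ℝ) =>
              H (β i) x - ∑ a : Fin n, c a * S x.1 (β i) a) (q t, p t) (0, Pi.single i 1) ∧
      deriv (fun s => p s i) t
        = -((S (q t))⁻¹ 0 (β i)) *
            fderiv ℝ (fun x : (Fin N → ℝ) × (Fin N → ℝ) =>
              H (β i) x - ∑ a : Fin n, c a * S x.1 (β i) a) (q t, p t) (Pi.single i 1, 0) := by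
  intro i t ht
  set K : Fin n → (Fin N → ℝ) × (Fin N → ℝ) → ℝ :=
    fun r x => H r x - ∑ a : Fin n, c a * S x.1 r a with hK
  have hS' : ∀ r j, Differentiable ℝ fun x : (Fin N → ℝ) × (Fin N → ℝ) => S x.1 r j :=
    fun r j => (hSdiff r j).comp differentiable_fst
  have hKdiff : ∀ r, Differentiable ℝ (K r) := by
    intro r
    have hg' : ∀ k l, Differentiable ℝ fun x : (Fin N → ℝ) × (Fin N → ℝ) => g r x.1 k l :=
      fun k l => (hgdiff r k l).comp differentiable_fst
    have hV' : Differentiable ℝ fun x : (Fin N → ℝ) × (Fin N → ℝ) => V r x.1 :=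
      (hVdiff r).comp differentiable_fst
    simp only [hK, hHr]
    fun_prop
  have hKzero : ∀ r, K r (q t, p t) = 0 := by
    intro r
    have hvec : (S (q t))⁻¹.mulVec (fun s => H s (q t, p t)) = c := funext fun a => hc t ht a
    have hmul : (S (q t)).mulVec c = fun s => H s (q t, p t) := by
      rw [← hvec, Matrix.mulVec_mulVec, Matrix.mul_nonsing_inv _ (hSinv _), Matrix.one_mulVec]
    have hr := congrFun hmul r
    simp only [Matrix.mulVec, dotProduct] at hr
    simp only [hK, ← hr, mul_comm (c _), sub_self]
  have hHtot_eq : Htot = fun x => ∑ r, (S x.1)⁻¹ 0 r * K r x + c 0 := by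
    funext x
    have hinv : (S x.1)⁻¹.mulVec ((S x.1).mulVec c) = c := by
      rw [Matrix.mulVec_mulVec, Matrix.nonsing_inv_mul _ (hSinv _), Matrix.one_mulVec]
    have h0 := congrFun hinv 0
    simp only [Matrix.mulVec, dotProduct] at h0
    simp only [hHtot, hK, mul_sub, Finset.sum_sub_distrib, mul_comm (c _), h0, sub_add_cancel]
  have hKline : ∀ r, β i ≠ r → ∀ v : (Fin N → ℝ) × (Fin N → ℝ),
      (v.1 = 0 ∨ v.1 = Pi.single i 1) → (∀ k, β k = r → v.2 k = 0) →
      fderiv ℝ (K r) (q t, p t) v = 0 := by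
    intro r hr v hv₁ hv₂
    have hfst : ∀ f : (Fin N → ℝ) → ℝ, Differentiable ℝ f →
        fderiv ℝ f (q t) (Pi.single i 1) = 0 →
        HasLineDerivAt ℝ (fun y : (Fin N → ℝ) × (Fin N → ℝ) => f y.1) 0 (q t, p t) v := by
      intro f hf hf0
      refine hasLineDerivAt_comp_fst_zero (hf _) ?_
      rcases hv₁ with h | h <;> simp [h, hf0]
    have hsnd : ∀ k, β k = r →
        HasLineDerivAt ℝ (fun y : (Fin N → ℝ) × (Fin N → ℝ) => y.2 k) 0 (q t, p t) v := by
      intro k hk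
      simp [HasLineDerivAt, hv₂ k hk, hasDerivAt_const]
    have hline : HasLineDerivAt ℝ (K r) 0 (q t, p t) v := by
      simp only [hK, hHr]
      have hquad := HasDerivAt.fun_sum (u := Finset.univ.filter fun k => β k = r) fun k hk =>
        HasDerivAt.fun_sum (u := Finset.univ.filter fun l => β l = r) fun l hl =>
          ((hfst _ (hgdiff r k l) (hgblock r k l i hr _)).fun_mul
            (hsnd k (Finset.mem_filter.1 hk).2)).fun_mul (hsnd l (Finset.mem_filter.1 hl).2)
      have hstackel := HasDerivAt.fun_sum (u := Finset.univ) fun a _ =>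
        HasDerivAt.const_mul (c a) (hfst _ (hSdiff r a) (hSblock r a i hr _))
      have h := ((hquad.const_mul (1 / 2)).fun_add
        (hfst _ (hVdiff r) (hVblock r i hr _))).fun_sub hstackel
      simpa [HasLineDerivAt] using h
    rw [← (hKdiff r _).lineDeriv_eq_fderiv, hline.lineDeriv]
  have hfderiv : ∀ v : (Fin N → ℝ) × (Fin N → ℝ),
      (v.1 = 0 ∨ v.1 = Pi.single i 1) → (∀ k, k ≠ i → v.2 k = 0) →
      fderiv ℝ Htot (q t, p t) v
        = (S (q t))⁻¹ 0 (β i) * fderiv ℝ (K (β i)) (q t, p t) v := by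
    intro v hv₁ hv₂
    rw [hHtot_eq, fderiv_add_const, fderiv_sum_mul_of_eq_zero
      (a := fun r (x : (Fin N → ℝ) × (Fin N → ℝ)) => (S x.1)⁻¹ 0 r)
      (fun r => differentiableAt_matrix_inv_apply (A := fun x : (Fin N → ℝ) × (Fin N → ℝ) => S x.1)
        (fun k l => hS' k l _) (hSinv _) 0 r)
      (fun r => hKdiff r _) hKzero]
    refine Finset.sum_eq_single _ (fun r _ hr => ?_) (by simp)
    rw [hKline r hr.symm v hv₁ fun k hk => hv₂ k ?_, mul_zero]
    rintro rfl
    exact hr hk.symm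
  obtain ⟨hq', hp'⟩ := hHam t ht i
  refine ⟨hq'.trans (hfderiv _ (Or.inl rfl) fun k hk => Pi.single_eq_of_ne hk _), ?_⟩
  rw [hp', hfderiv _ (Or.inr rfl) fun k _ => rfl, neg_mul]
end

section
/- Fix a block assignment β : Fin N → Fin n. Let B : ℝ^N → Matrix (Fin n) (Fin n) ℝ be differentiable with B(q) invertible and B(q)_{1,r} ≠ 0 for every q ∈ ℝ^N and r ∈ Fin n. Set α^r = B_{1,r} and λ_a^r = B_{a,r}/B_{1,r}. Then the block-Eisenhart equations α^s(q) · ∂_i λ_a^s(q) = (λ_a^{β(i)}(q) − λ_a^s(q)) · ∂_i α^s(q), for all a, s ∈ Fin n and all i ∈ Fin N, hold identically on ℝ^N if and only if the inverse matrix S = B^{-1} is a block-Stäckel matrix, i.e. ∂_i(S_{r,j}) = 0 whenever β(i) ≠ r. -/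
open scoped BigOperators

/-- The determinant of a matrix with differentiable entries is differentiable. -/
theorem differentiable_matrix_det_s8 {E : Type*} [NormedAddCommGroup E] [NormedSpace ℝ E]
    {ι : Type*} [Fintype ι] [DecidableEq ι] {M : E → Matrix ι ι ℝ}
    (hM : ∀ a r, Differentiable ℝ (fun q => M q a r)) :
    Differentiable ℝ (fun q => (M q).det) := by
  simp only [Matrix.det_apply]
  fun_prop

/-- The entries of the inverse of an invertible matrix with differentiable entries are
differentiable. -/
theorem differentiable_matrix_inv {E : Type*} [NormedAddCommGroup E] [NormedSpace ℝ E]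
    {ι : Type*} [Fintype ι] [DecidableEq ι] {M : E → Matrix ι ι ℝ}
    (hM : ∀ a r, Differentiable ℝ (fun q => M q a r)) (hdet : ∀ q, IsUnit (M q).det)
    (r j : ι) : Differentiable ℝ (fun q => (M q)⁻¹ r j) := by
  simp only [Matrix.inv_def, Matrix.smul_apply, Ring.inverse_eq_inv', smul_eq_mul,
    Matrix.adjugate_apply]
  refine ((differentiable_matrix_det_s8 hM).inv fun q => (hdet q).ne_zero).mul
    (differentiable_matrix_det_s8 fun a b => ?_)
  by_cases h : a = j
  · subst h
    simp
  · simpa [Matrix.updateRow_ne h] using hM a b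

/-- The product rule for `B⁻¹ * B = 1`, in the direction `v`. -/
theorem fderiv_matrix_inv_mul_add {E : Type*} [NormedAddCommGroup E] [NormedSpace ℝ E]
    {ι : Type*} [Fintype ι] [DecidableEq ι] {M : E → Matrix ι ι ℝ}
    (hM : ∀ a r, Differentiable ℝ (fun q => M q a r)) (hdet : ∀ q, IsUnit (M q).det)
    (q v : E) :
    Matrix.of (fun r j => fderiv ℝ (fun q' => (M q')⁻¹ r j) q v) * M q
      + (M q)⁻¹ * Matrix.of (fun a s => fderiv ℝ (fun q' => M q' a s) q v) = 0 := by
  ext r s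
  have hprod : (fun q' => ∑ a, (M q')⁻¹ r a * M q' a s) =
      fun _ => (1 : Matrix ι ι ℝ) r s := by
    funext q'
    rw [← Matrix.nonsing_inv_mul (M q') (hdet q'), Matrix.mul_apply]
  have hder : HasFDerivAt (fun q' => ∑ a, (M q')⁻¹ r a * M q' a s)
      (∑ a, ((M q)⁻¹ r a • fderiv ℝ (fun q' => M q' a s) q
        + M q a s • fderiv ℝ (fun q' => (M q')⁻¹ r a) q)) q :=
    HasFDerivAt.fun_sum fun a _ =>
      (differentiable_matrix_inv hM hdet r a q).hasFDerivAt.mul (hM a s q).hasFDerivAt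
  rw [hprod] at hder
  have hzero := congrArg (fun L => L v) (hder.unique (hasFDerivAt_const _ q))
  simp only [sum_apply, add_apply,
    smul_apply, smul_eq_mul, zero_apply,
    Finset.sum_add_distrib] at hzero
  simp only [Matrix.add_apply, Matrix.mul_apply, Matrix.of_apply, Matrix.zero_apply]
  rw [add_comm, ← hzero]
  simp only [mul_comm]

/-- If `E * B + B⁻¹ * D = 0`, then `E` is supported on row `k` exactly when every column of `D`
is a multiple of column `k` of `B`. -/
theorem rows_eq_zero_iff_exists_eq_vecMulVec {ι K : Type*} [Fintype ι] [DecidableEq ι] [Field K]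
    {B D E : Matrix ι ι K} (hB : IsUnit B.det) (h : E * B + B⁻¹ * D = 0) (k : ι) :
    (∀ r, k ≠ r → ∀ j, E r j = 0) ↔ ∃ c : ι → K, D = Matrix.vecMulVec (fun a => B a k) c := by
  constructor
  · intro hE
    have hD : D = -(B * (E * B)) := by
      rw [eq_neg_of_add_eq_zero_left h, mul_neg, neg_neg, Matrix.mul_nonsing_inv_cancel_left _ _ hB]
    refine ⟨fun s => -(E * B) k s, ?_⟩
    ext a s
    rw [hD, Matrix.neg_apply, Matrix.mul_apply, Finset.sum_eq_single k, Matrix.vecMulVec_apply,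
      mul_neg]
    · intro r _ hr
      simp [Matrix.mul_apply, hE r hr.symm]
    · simp
  · rintro ⟨c, rfl⟩ r hr j
    have hE : E = -(B⁻¹ * Matrix.vecMulVec (fun a => B a k) c) * B⁻¹ := by
      rw [← eq_neg_of_add_eq_zero_left h, Matrix.mul_nonsing_inv_cancel_right _ _ hB]
    have hcol : B⁻¹.mulVec (fun a => B a k) r = 0 := by
      have := congrFun (congrFun (Matrix.nonsing_inv_mul B hB) r) k
      rwa [Matrix.mul_apply, Matrix.one_apply_ne hr.symm] at this
    rw [hE, Matrix.mul_vecMulVec, Matrix.mul_apply]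
    simp [Matrix.vecMulVec_apply, hcol]

/-- The Eisenhart equation at a point, with the quotient rule carried out. -/
theorem eisenhart_iff_fderiv_eq {E : Type*} [NormedAddCommGroup E] [NormedSpace ℝ E]
    {f g : E → ℝ} {q : E} (hf : DifferentiableAt ℝ f q) (hg : DifferentiableAt ℝ g q)
    (hg0 : g q ≠ 0) (v : E) (l : ℝ) :
    g q * fderiv ℝ (fun q' => f q' / g q') q v = (l - f q / g q) * fderiv ℝ g q v
      ↔ fderiv ℝ f q v = l * fderiv ℝ g q v := by
  have hquot : g q * fderiv ℝ (fun q' => f q' / g q') q v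
      = fderiv ℝ f q v - f q / g q * fderiv ℝ g q v := by
    have hd := hf.hasFDerivAt.fun_mul ((hasDerivAt_inv hg0).comp_hasFDerivAt q hg.hasFDerivAt)
    simp only [Function.comp_apply, ← div_eq_mul_inv] at hd
    rw [hd.fderiv]
    simp
    field_simp
    ring
  rw [hquot, sub_mul, sub_left_inj]

/-- Let `B : ℝ^N → Matrix (Fin n) (Fin n) ℝ` be differentiable
with `B(q)` invertible and `B(q)_{1,r} ≠ 0` everywhere; set `α^r = B_{1,r}` and
`λ_a^r = B_{a,r}/B_{1,r}`. Then the block-Eisenhart equations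
`α^s ∂_i λ_a^s = (λ_a^{β(i)} − λ_a^s) ∂_i α^s` hold identically if and only if
`S = B⁻¹` is a block-Stäckel matrix (each entry of row `r` of `S` depends only
on the `r`-block: `∂_i S_{r,j} = 0` whenever `β i ≠ r`). -/
theorem stmt_8 (N n : ℕ) [NeZero n] (β : Fin N → Fin n) (hβ : Function.Surjective β)
    (B : (Fin N → ℝ) → Matrix (Fin n) (Fin n) ℝ)
    (hBdiff : ∀ a r : Fin n, Differentiable ℝ (fun q => B q a r))
    (hBinv : ∀ q, IsUnit (B q).det)
    (hBne : ∀ (q : Fin N → ℝ) (r : Fin n), B q 0 r ≠ 0) :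
    (∀ (a s : Fin n) (i : Fin N) (q : Fin N → ℝ),
      B q 0 s * fderiv ℝ (fun q' => B q' a s / B q' 0 s) q (Pi.single i 1)
        = (B q a (β i) / B q 0 (β i) - B q a s / B q 0 s)
            * fderiv ℝ (fun q' => B q' 0 s) q (Pi.single i 1))
    ↔ (∀ (r j : Fin n) (i : Fin N), β i ≠ r →
        ∀ q : Fin N → ℝ, fderiv ℝ (fun q' => (B q')⁻¹ r j) q (Pi.single i 1) = 0) := by
  have key : ∀ (i : Fin N) (q : Fin N → ℝ),
      (∀ a s, B q 0 s * fderiv ℝ (fun q' => B q' a s / B q' 0 s) q (Pi.single i 1)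
        = (B q a (β i) / B q 0 (β i) - B q a s / B q 0 s)
            * fderiv ℝ (fun q' => B q' 0 s) q (Pi.single i 1)) ↔
      ∀ r, β i ≠ r → ∀ j, fderiv ℝ (fun q' => (B q')⁻¹ r j) q (Pi.single i 1) = 0 := by
    intro i q
    refine Iff.trans ?_ (rows_eq_zero_iff_exists_eq_vecMulVec (hBinv q)
      (fderiv_matrix_inv_mul_add hBdiff hBinv q (Pi.single i 1)) (β i)).symm
    simp only [fun a s => eisenhart_iff_fderiv_eq (hBdiff a s q) (hBdiff 0 s q) (hBne q s)
      (Pi.single i 1) (B q a (β i) / B q 0 (β i))]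
    constructor
    · intro h
      refine ⟨fun s => fderiv ℝ (fun q' => B q' 0 s) q (Pi.single i 1) / B q 0 (β i), ?_⟩
      ext a s
      rw [Matrix.of_apply, h a s, Matrix.vecMulVec_apply]
      ring
    · rintro ⟨c, hc⟩ a s
      have hentry : ∀ a, fderiv ℝ (fun q' => B q' a s) q (Pi.single i 1) = B q a (β i) * c s :=
        fun a => congrFun (congrFun hc a) s
      have := hBne q (β i)
      rw [hentry a, hentry 0]
      field_simp
  exact ⟨fun h r j i hr q => (key i q).1 (fun a s => h a s i q) r hr j,
    fun h a s i q => (key i q).2 (fun r hr j => h r j i hr q) a s⟩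
end

section
/- Fix a block assignment β : Fin N → Fin n. For each r ∈ Fin n let g_r^{ij} (indices i, j in the r-block) be differentiable functions on ℝ^N, depending only on the r-block coordinates, such that for every q the symmetric matrix (g_r^{ij}(q)) is invertible. Let α^r and α_a^r (a ∈ Fin n) be differentiable nowhere-vanishing functions on ℝ^N and set λ_a^r = α_a^r/α^r. Define H(q,p) = ½ Σ_r α^r(q) Σ_{β(i)=β(j)=r} g_r^{ij}(q) p_i p_j and K_a(q,p) = ½ Σ_r α_a^r(q) Σ_{β(i)=β(j)=r} g_r^{ij}(q) p_i p_j. Then the canonical Poisson bracket {H, K_a} vanishes identically on ℝ^N × ℝ^N if and only if the block-Eisenhart equations α^s(q) · ∂_i λ_a^s(q) = (λ_a^{β(i)}(q) − λ_a^s(q)) · ∂_i α^s(q) hold for all s ∈ Fin n, all i ∈ Fin N, and all q ∈ ℝ^N. -/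
open scoped BigOperators

/-- Let `∑ r, ω r p * B r p p` vanish identically. If `y` lies in the kernel of every `B s` with
`s ≠ r` and is not isotropic for `B r`, then the linear form `ω r` is zero. -/
theorem linearForm_eq_zero_of_sum_mul_quadratic_eq_zero {κ V : Type*} [Fintype κ]
    [AddCommGroup V] [Module ℝ V] (B : κ → LinearMap.BilinForm ℝ V) (hB : ∀ r x y, B r x y = B r y x)
    (ω : κ → V →ₗ[ℝ] ℝ) (h : ∀ p, ∑ r, ω r p * B r p p = 0) (r : κ) (y : V)
    (hy : ∀ s, s ≠ r → B s y = 0) (hyr : B r y y ≠ 0) : ω r = 0 := by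
  have hωy : ω r y = 0 := by
    have h1 := h y
    rw [Finset.sum_eq_single r (fun s _ hs => by simp [hy s hs]) (by simp)] at h1
    exact (mul_eq_zero.mp h1).resolve_right hyr
  ext x
  have h2 : ∑ s, (ω s (x + y) * B s (x + y) (x + y) + ω s (x - y) * B s (x - y) (x - y)
      - 2 * (ω s x * B s x x)) = 0 := by
    rw [Finset.sum_sub_distrib, Finset.sum_add_distrib, ← Finset.mul_sum, h, h, h]
    simp
  rw [Finset.sum_eq_single r ?_ (by simp)] at h2
  · simp only [map_add, map_sub, LinearMap.add_apply, LinearMap.sub_apply, hωy] at h2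
    have h3 : ω r x * B r y y = 0 := by linarith
    simpa using (mul_eq_zero.mp h3).resolve_right hyr
  · intro s _ hs
    simp only [map_add, map_sub, LinearMap.add_apply, LinearMap.sub_apply, hB s x y, hy s hs,
      LinearMap.zero_apply]
    ring

/-- The matrix `G` cut down to its diagonal `r`-block, all other entries being replaced by `0`. -/
def blockPart {N n : ℕ} (β : Fin N → Fin n) (r : Fin n) (G : Fin N → Fin N → ℝ) :
    Matrix (Fin N) (Fin N) ℝ :=
  Matrix.of fun i j => if β i = r then if β j = r then G i j else 0 else 0

section LinearAlgebra

variable {N n : ℕ} (β : Fin N → Fin n)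

theorem blockPart_symm (r : Fin n) (G : Fin N → Fin N → ℝ) (hG : ∀ i j, G i j = G j i)
    (i j : Fin N) : blockPart β r G i j = blockPart β r G j i := by
  simp only [blockPart, Matrix.of_apply, hG i j]
  split_ifs <;> rfl

theorem blockPart_of_ne (r : Fin n) (G : Fin N → Fin N → ℝ) (i j : Fin N) (hi : β i ≠ r) :
    blockPart β r G i j = 0 := by
  simp [blockPart, hi]

theorem sum_filter_eq_dotProduct_blockPart (r : Fin n) (G : Fin N → Fin N → ℝ)
    (p : Fin N → ℝ) :
    ∑ i ∈ Finset.univ.filter (fun i => β i = r),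
        ∑ j ∈ Finset.univ.filter (fun j => β j = r), G i j * p i * p j
      = ∑ i, ∑ j, blockPart β r G i j * p i * p j := by
  simp only [Finset.sum_filter, blockPart, Matrix.of_apply]
  refine Finset.sum_congr rfl fun i _ => ?_
  split_ifs
  · refine Finset.sum_congr rfl fun j _ => ?_
    split_ifs <;> simp
  · simp

/-- A nondegenerate symmetric nonempty block has a non-isotropic vector supported on the block. -/
theorem exists_blockPart_not_isotropic (r : Fin n) (hr : ∃ i, β i = r)
    (G : Fin N → Fin N → ℝ) (hG : ∀ i j, G i j = G j i)
    (hdet : IsUnit (Matrix.det (Matrix.of fun i j : {i : Fin N // β i = r} => G i.1 j.1))) :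
    ∃ y : Fin N → ℝ, (∀ i, β i ≠ r → y i = 0) ∧
      Matrix.toBilin' (blockPart β r G) y y ≠ 0 := by
  by_contra! hcon
  have hsupp : ∀ i : {i : Fin N // β i = r}, ∀ k, β k ≠ r →
      (Pi.single i.1 (1 : ℝ) : Fin N → ℝ) k = 0 := by
    intro i k hk
    rw [Pi.single_apply, if_neg]
    rintro rfl
    exact hk i.2
  have hzero : (Matrix.of fun i j : {i : Fin N // β i = r} => G i.1 j.1) = 0 := by
    ext i j
    have h1 := hcon _ (hsupp i)
    have h2 := hcon _ (hsupp j)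
    have h3 := hcon (Pi.single i.1 1 + Pi.single j.1 1) fun k hk => by
      simp [hsupp i k hk, hsupp j k hk]
    simp only [map_add, LinearMap.add_apply, Matrix.toBilin'_single] at h1 h2 h3
    rw [h1, h2, blockPart_symm β r G hG j i] at h3
    have h4 : blockPart β r G i j = G i j := by simp [blockPart, i.2, j.2]
    simp only [Matrix.of_apply, Matrix.zero_apply]
    linarith
  obtain ⟨i, hi⟩ := hr
  have : Nonempty {i : Fin N // β i = r} := ⟨⟨i, hi⟩⟩
  rw [hzero, Matrix.det_zero] at hdet
  simp at hdet

/-- The cubic polynomial `∑ i, ∑ r, E i r * (∂ᵢ of the β i form) * (r-th form)` vanishes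
identically only if all its coefficients `E i r` do. -/
theorem coeff_eq_zero_of_cubic_eq_zero (hβ : Function.Surjective β)
    (G : Fin n → Fin N → Fin N → ℝ) (hG : ∀ r i j, G r i j = G r j i)
    (hdet : ∀ r, IsUnit
      (Matrix.det (Matrix.of fun i j : {i : Fin N // β i = r} => G r i.1 j.1)))
    (E : Fin N → Fin n → ℝ)
    (h : ∀ p : Fin N → ℝ, ∑ i, ∑ r, E i r * (∑ j, blockPart β (β i) (G (β i)) i j * p j) *
      (∑ k, ∑ l, blockPart β r (G r) k l * p k * p l) = 0) (i : Fin N) (r : Fin n) :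
    E i r = 0 := by
  let ω : Fin n → (Fin N → ℝ) →ₗ[ℝ] ℝ := fun r =>
    ∑ i, E i r • ∑ j, blockPart β (β i) (G (β i)) i j • LinearMap.proj j
  have hω : ∀ r p, ω r p = ∑ i, E i r * ∑ j, blockPart β (β i) (G (β i)) i j * p j := by
    intro r p
    simp [ω, LinearMap.sum_apply]
  obtain ⟨y, hy, hyr⟩ := exists_blockPart_not_isotropic β r (hβ r) (G r) (hG r) (hdet r)
  have hωr : ω r = 0 := by
    refine linearForm_eq_zero_of_sum_mul_quadratic_eq_zero
      (fun r => Matrix.toBilin' (blockPart β r (G r))) ?_ ω ?_ r y ?_ hyr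
    · intro r x y
      simp only [Matrix.toBilin'_apply]
      rw [Finset.sum_comm]
      refine Finset.sum_congr rfl fun j _ => Finset.sum_congr rfl fun i _ => ?_
      rw [blockPart_symm β r (G r) (hG r) i j]
      ring
    · intro p
      rw [← h p, Finset.sum_comm]
      refine Finset.sum_congr rfl fun r _ => ?_
      rw [hω, Finset.sum_mul]
      refine Finset.sum_congr rfl fun i _ => ?_
      congr 1
      rw [Matrix.toBilin'_apply]
      refine Finset.sum_congr rfl fun i _ => Finset.sum_congr rfl fun j _ => ?_
      ring
    · intro s hs
      ext x
      simp only [LinearMap.comp_apply, LinearMap.zero_apply, Matrix.toBilin'_apply]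
      refine Finset.sum_eq_zero fun i _ => Finset.sum_eq_zero fun j _ => ?_
      by_cases hi : β i = r
      · rw [blockPart_of_ne β s (G s) i j (fun hc => hs (hc.symm.trans hi))]
        ring
      · rw [hy i hi]
        ring
  have hvec : Matrix.vecMul (fun k : {k : Fin N // β k = β i} => E k.1 r)
      (Matrix.of fun k l : {k : Fin N // β k = β i} => G (β i) k.1 l.1) = 0 := by
    ext l
    have h1 := hω r (Pi.single l.1 1)
    rw [hωr, LinearMap.zero_apply] at h1
    rw [Pi.zero_apply, h1]
    simp only [Matrix.vecMul, dotProduct, Matrix.of_apply, Pi.single_apply, mul_ite, mul_one,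
      mul_zero, Finset.sum_ite_eq', Finset.mem_univ, if_true]
    rw [← Finset.sum_subtype (Finset.univ.filter fun k => β k = β i) (by simp)
      (fun k => E k r * G (β i) k l), Finset.sum_filter]
    refine Finset.sum_congr rfl fun k _ => ?_
    by_cases hk : β k = β i
    · simp [blockPart, hk, l.2]
    · have hlk : β l.1 ≠ β k := fun hc => hk (hc.symm.trans l.2)
      simp [blockPart, hk, hlk]
  have h0 := Matrix.eq_zero_of_vecMul_eq_zero (hdet (β i)).ne_zero hvec
  exact congrFun h0 ⟨i, rfl⟩

end LinearAlgebra

section Derivatives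

variable {N n : ℕ} (β : Fin N → Fin n) (g : Fin n → (Fin N → ℝ) → Fin N → Fin N → ℝ)

theorem differentiable_blockPart (hg : ∀ r i j, Differentiable ℝ (fun q => g r q i j))
    (r : Fin n) (i j : Fin N) : Differentiable ℝ (fun q => blockPart β r (g r q) i j) := by
  simp only [blockPart, Matrix.of_apply]
  split_ifs
  · exact hg r i j
  · exact differentiable_const _
  · exact differentiable_const _

theorem fderiv_blockPart_of_ne
    (hg : ∀ (r : Fin n) (i j : Fin N) (k : Fin N), β k ≠ r →
      ∀ q : Fin N → ℝ, fderiv ℝ (fun q' => g r q' i j) q (Pi.single k 1) = 0)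
    (r : Fin n) (i j k : Fin N) (hk : β k ≠ r) (q : Fin N → ℝ) :
    fderiv ℝ (fun q' => blockPart β r (g r q') i j) q (Pi.single k 1) = 0 := by
  simp only [blockPart, Matrix.of_apply]
  split_ifs
  · exact hg r i j k hk q
  · simp
  · simp

variable (A : Fin n → (Fin N → ℝ) → ℝ) (F : (Fin N → ℝ) × (Fin N → ℝ) → ℝ)

/-- The differential of a block-diagonal quadratic Hamiltonian. -/
theorem fderiv_blockHamiltonian (hg : ∀ r i j, Differentiable ℝ (fun q => g r q i j))
    (hA : ∀ r, Differentiable ℝ (A r))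
    (hF : ∀ x, F x = (1 / 2) * ∑ r, A r x.1 *
      ∑ i, ∑ j, blockPart β r (g r x.1) i j * x.2 i * x.2 j)
    (q p u w : Fin N → ℝ) :
    fderiv ℝ F (q, p) (u, w) = (1 / 2) * ∑ r,
      (fderiv ℝ (A r) q u * (∑ i, ∑ j, blockPart β r (g r q) i j * p i * p j)
        + A r q * ∑ i, ∑ j,
          (fderiv ℝ (fun q' => blockPart β r (g r q') i j) q u * p i * p j
            + blockPart β r (g r q) i j * w i * p j
            + blockPart β r (g r q) i j * p i * w j)) := by
  have hfst : HasFDerivAt (Prod.fst : (Fin N → ℝ) × (Fin N → ℝ) → (Fin N → ℝ))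
      (ContinuousLinearMap.fst ℝ _ _) (q, p) := hasFDerivAt_fst
  have hsnd : ∀ i, HasFDerivAt (fun x : (Fin N → ℝ) × (Fin N → ℝ) => x.2 i)
      ((ContinuousLinearMap.proj i).comp (ContinuousLinearMap.snd ℝ _ (Fin N → ℝ))) (q, p) :=
    fun i => ((ContinuousLinearMap.proj i).comp
      (ContinuousLinearMap.snd ℝ (Fin N → ℝ) (Fin N → ℝ))).hasFDerivAt
  have hA' : ∀ r, HasFDerivAt (fun x : (Fin N → ℝ) × (Fin N → ℝ) => A r x.1)
      ((fderiv ℝ (A r) q).comp (ContinuousLinearMap.fst ℝ _ _)) (q, p) :=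
    fun r => HasFDerivAt.comp (q, p) (hA r q).hasFDerivAt hfst
  have hM : ∀ r i j, HasFDerivAt
      (fun x : (Fin N → ℝ) × (Fin N → ℝ) => blockPart β r (g r x.1) i j)
      ((fderiv ℝ (fun q' => blockPart β r (g r q') i j) q).comp
        (ContinuousLinearMap.fst ℝ _ _)) (q, p) :=
    fun r i j => HasFDerivAt.comp (q, p) (g := fun q' => blockPart β r (g r q') i j)
      (differentiable_blockPart β g hg r i j q).hasFDerivAt hfst
  have hFd := (HasFDerivAt.fun_sum (u := Finset.univ) fun r _ => (hA' r).mul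
    (HasFDerivAt.fun_sum (u := Finset.univ) fun i _ =>
      HasFDerivAt.fun_sum (u := Finset.univ) fun j _ =>
        ((hM r i j).mul (hsnd i)).mul (hsnd j))).const_mul (1 / 2 : ℝ)
  have hFd' : HasFDerivAt F _ (q, p) := hFd.congr_of_eventuallyEq (.of_forall hF)
  rw [hFd'.fderiv]
  simp only [_root_.smul_apply, _root_.sum_apply,
    _root_.add_apply, ContinuousLinearMap.comp_apply, ContinuousLinearMap.coe_fst',
    ContinuousLinearMap.coe_snd', ContinuousLinearMap.proj_apply, smul_eq_mul, Pi.mul_apply]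
  congr 1
  refine Finset.sum_congr rfl fun r _ => ?_
  rw [add_comm, mul_comm (fderiv ℝ (A r) q u)]
  congr 2
  refine Finset.sum_congr rfl fun i _ => Finset.sum_congr rfl fun j _ => ?_
  ring

theorem fderiv_blockHamiltonian_momentum (hg : ∀ r i j, Differentiable ℝ (fun q => g r q i j))
    (hgsymm : ∀ r q i j, g r q i j = g r q j i)
    (hA : ∀ r, Differentiable ℝ (A r))
    (hF : ∀ x, F x = (1 / 2) * ∑ r, A r x.1 *
      ∑ i, ∑ j, blockPart β r (g r x.1) i j * x.2 i * x.2 j)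
    (q p : Fin N → ℝ) (k : Fin N) :
    fderiv ℝ F (q, p) (0, Pi.single k 1) =
      A (β k) q * ∑ j, blockPart β (β k) (g (β k) q) k j * p j := by
  have hsum : ∀ r, ∑ i, ∑ j,
      (blockPart β r (g r q) i j * (Pi.single k 1 : Fin N → ℝ) i * p j
        + blockPart β r (g r q) i j * p i * (Pi.single k 1 : Fin N → ℝ) j)
      = 2 * ∑ j, blockPart β r (g r q) k j * p j := by
    intro r
    simp only [Finset.sum_add_distrib]
    rw [Finset.sum_comm, two_mul]
    simp [Pi.single_apply, blockPart_symm β r (g r q) (hgsymm r q) _ k]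
  rw [fderiv_blockHamiltonian β g A F hg hA hF]
  simp only [map_zero, zero_mul, zero_add, hsum]
  rw [Finset.sum_eq_single (β k) ?_ (by simp)]
  · ring
  · intro r _ hr
    simp [blockPart_of_ne β r (g r q) k _ hr.symm]

theorem fderiv_blockHamiltonian_position (hg : ∀ r i j, Differentiable ℝ (fun q => g r q i j))
    (hgblock : ∀ (r : Fin n) (i j : Fin N) (k : Fin N), β k ≠ r →
      ∀ q : Fin N → ℝ, fderiv ℝ (fun q' => g r q' i j) q (Pi.single k 1) = 0)
    (hA : ∀ r, Differentiable ℝ (A r))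
    (hF : ∀ x, F x = (1 / 2) * ∑ r, A r x.1 *
      ∑ i, ∑ j, blockPart β r (g r x.1) i j * x.2 i * x.2 j)
    (q p : Fin N → ℝ) (k : Fin N) :
    fderiv ℝ F (q, p) (Pi.single k 1, 0) =
      (1 / 2) * ∑ r, fderiv ℝ (A r) q (Pi.single k 1) *
          (∑ i, ∑ j, blockPart β r (g r q) i j * p i * p j)
        + A (β k) q * ((1 / 2) * ∑ i, ∑ j,
          fderiv ℝ (fun q' => blockPart β (β k) (g (β k) q') i j) q (Pi.single k 1)
            * p i * p j) := by
  rw [fderiv_blockHamiltonian β g A F hg hA hF]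
  simp only [Pi.zero_apply, mul_zero, zero_mul, add_zero]
  rw [Finset.sum_add_distrib, mul_add]
  congr 1
  rw [Finset.sum_eq_single (β k) ?_ (by simp)]
  · ring
  · intro r _ hr
    simp [fderiv_blockPart_of_ne β g hgblock r _ _ k hr.symm]

/-- The Poisson bracket of two Hamiltonians with the same blocks `g r` and different conformal
factors. -/
theorem poissonBracket_blockHamiltonian
    (C : Fin n → (Fin N → ℝ) → ℝ) (F' : (Fin N → ℝ) × (Fin N → ℝ) → ℝ)
    (hg : ∀ r i j, Differentiable ℝ (fun q => g r q i j))
    (hgsymm : ∀ r q i j, g r q i j = g r q j i)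
    (hgblock : ∀ (r : Fin n) (i j : Fin N) (k : Fin N), β k ≠ r →
      ∀ q : Fin N → ℝ, fderiv ℝ (fun q' => g r q' i j) q (Pi.single k 1) = 0)
    (hA : ∀ r, Differentiable ℝ (A r)) (hC : ∀ r, Differentiable ℝ (C r))
    (hF : ∀ x, F x = (1 / 2) * ∑ r, A r x.1 *
      ∑ i, ∑ j, blockPart β r (g r x.1) i j * x.2 i * x.2 j)
    (hF' : ∀ x, F' x = (1 / 2) * ∑ r, C r x.1 *
      ∑ i, ∑ j, blockPart β r (g r x.1) i j * x.2 i * x.2 j)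
    (q p : Fin N → ℝ) :
    poissonBracket F F' (q, p) = (1 / 2) * ∑ i, ∑ r,
      (A (β i) q * fderiv ℝ (C r) q (Pi.single i 1)
          - C (β i) q * fderiv ℝ (A r) q (Pi.single i 1))
        * (∑ j, blockPart β (β i) (g (β i) q) i j * p j)
        * (∑ k, ∑ l, blockPart β r (g r q) k l * p k * p l) := by
  rw [poissonBracket, Finset.mul_sum]
  refine Finset.sum_congr rfl fun i _ => ?_
  rw [fderiv_blockHamiltonian_momentum β g A F hg hgsymm hA hF,
    fderiv_blockHamiltonian_momentum β g C F' hg hgsymm hC hF',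
    fderiv_blockHamiltonian_position β g A F hg hgblock hA hF,
    fderiv_blockHamiltonian_position β g C F' hg hgblock hC hF']
  generalize (∑ j, blockPart β (β i) (g (β i) q) i j * p j) = v
  have hsplit : ∑ r, (A (β i) q * fderiv ℝ (C r) q (Pi.single i 1)
          - C (β i) q * fderiv ℝ (A r) q (Pi.single i 1)) * v
        * (∑ k, ∑ l, blockPart β r (g r q) k l * p k * p l)
      = A (β i) q * v * (∑ r, fderiv ℝ (C r) q (Pi.single i 1) *
          (∑ k, ∑ l, blockPart β r (g r q) k l * p k * p l))
        - C (β i) q * v * (∑ r, fderiv ℝ (A r) q (Pi.single i 1) *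
          (∑ k, ∑ l, blockPart β r (g r q) k l * p k * p l)) := by
    rw [Finset.mul_sum, Finset.mul_sum, ← Finset.sum_sub_distrib]
    refine Finset.sum_congr rfl fun r _ => ?_
    ring
  rw [hsplit]
  ring

end Derivatives

/-- The Eisenhart equation at one point, cleared of denominators. -/
theorem eisenhart_iff {E : Type*} [NormedAddCommGroup E] [NormedSpace ℝ E] {a c : E → ℝ} {q : E}
    (ha : DifferentiableAt ℝ a q) (hc : DifferentiableAt ℝ c q) (ha0 : a q ≠ 0)
    {b d : ℝ} (hb : b ≠ 0) (u : E) :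
    a q * fderiv ℝ (fun q' => c q' / a q') q u = (d / b - c q / a q) * fderiv ℝ a q u ↔
      b * fderiv ℝ c q u - d * fderiv ℝ a q u = 0 := by
  have hdiv : fderiv ℝ (fun q' => c q' / a q') q u * a q + c q / a q * fderiv ℝ a q u
      = fderiv ℝ c q u := by
    have heq : (fun q' => c q' / a q' * a q') =ᶠ[nhds q] c :=
      (ha.continuousAt.eventually_ne ha0).mono fun q' hq' => div_mul_cancel₀ (c q') hq'
    have hd : DifferentiableAt ℝ (fun q' => c q' / a q') q := by
      simp only [div_eq_mul_inv]
      exact hc.mul (ha.inv ha0)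
    rw [← heq.fderiv_eq, fderiv_fun_mul hd ha]
    simp only [_root_.add_apply, _root_.smul_apply, smul_eq_mul]
    ring
  have hbd : b * (d / b) = d := by field_simp
  rw [← hdiv]
  constructor
  · intro h
    linear_combination b * h + fderiv ℝ a q u * hbd
  · intro h
    refine mul_left_cancel₀ hb ?_
    linear_combination h - fderiv ℝ a q u * hbd

/-- For block-diagonal quadratic Hamiltonians
`H = ½ ∑ r α^r ∑_{β(i)=β(j)=r} g_r^{ij} p_i p_j` and
`K_a = ½ ∑ r α_a^r ∑_{β(i)=β(j)=r} g_r^{ij} p_i p_j`, with `λ_a^r = α_a^r/α^r`,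
the Poisson bracket `{H, K_a}` vanishes identically if and only if the
block-Eisenhart equations
`α^s ∂_i λ_a^s = (λ_a^{β(i)} − λ_a^s) ∂_i α^s` hold everywhere. -/
theorem stmt_9 (N n : ℕ) (β : Fin N → Fin n) (hβ : Function.Surjective β)
    (g : Fin n → (Fin N → ℝ) → Fin N → Fin N → ℝ)
    (hgdiff : ∀ r i j, Differentiable ℝ (fun q => g r q i j))
    (hgsymm : ∀ r q i j, g r q i j = g r q j i)
    (hgblock : ∀ (r : Fin n) (i j : Fin N) (k : Fin N), β k ≠ r →
      ∀ q : Fin N → ℝ, fderiv ℝ (fun q' => g r q' i j) q (Pi.single k 1) = 0)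
    (hginv : ∀ (r : Fin n) (q : Fin N → ℝ),
      IsUnit (Matrix.det (Matrix.of fun i j : {i : Fin N // β i = r} => g r q i.1 j.1)))
    (α : Fin n → (Fin N → ℝ) → ℝ) (αa : Fin n → Fin n → (Fin N → ℝ) → ℝ)
    (hαdiff : ∀ r, Differentiable ℝ (α r))
    (hαadiff : ∀ a r, Differentiable ℝ (αa a r))
    (hαne : ∀ r q, α r q ≠ 0) (hαane : ∀ a r q, αa a r q ≠ 0)
    (H : (Fin N → ℝ) × (Fin N → ℝ) → ℝ)
    (hH : ∀ x, H x = (1 / 2) * ∑ r : Fin n, α r x.1 *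
      ∑ i ∈ Finset.univ.filter (fun i => β i = r),
        ∑ j ∈ Finset.univ.filter (fun j => β j = r), g r x.1 i j * x.2 i * x.2 j)
    (K : Fin n → (Fin N → ℝ) × (Fin N → ℝ) → ℝ)
    (hK : ∀ a x, K a x = (1 / 2) * ∑ r : Fin n, αa a r x.1 *
      ∑ i ∈ Finset.univ.filter (fun i => β i = r),
        ∑ j ∈ Finset.univ.filter (fun j => β j = r), g r x.1 i j * x.2 i * x.2 j) :
    ∀ a : Fin n,
      (poissonBracket H (K a) = 0 ↔
        ∀ (s : Fin n) (i : Fin N) (q : Fin N → ℝ),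
          α s q * fderiv ℝ (fun q' => αa a s q' / α s q') q (Pi.single i 1)
            = (αa a (β i) q / α (β i) q - αa a s q / α s q)
                * fderiv ℝ (α s) q (Pi.single i 1)) := by
  intro a
  simp only [sum_filter_eq_dotProduct_blockPart] at hH hK
  have hbr := poissonBracket_blockHamiltonian β g α H (αa a) (K a) hgdiff hgsymm hgblock
    hαdiff (hαadiff a) hH (hK a)
  have heis := fun s i q => eisenhart_iff (hαdiff s q) (hαadiff a s q) (hαne s q)
    (d := αa a (β i) q) (hαne (β i) q) (Pi.single i 1)
  simp only [heis]
  constructor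
  · intro h s i q
    refine coeff_eq_zero_of_cubic_eq_zero β hβ (fun r => g r q) (fun r => hgsymm r q)
      (fun r => hginv r q)
      (fun i r => α (β i) q * fderiv ℝ (αa a r) q (Pi.single i 1)
          - αa a (β i) q * fderiv ℝ (α r) q (Pi.single i 1)) (fun p => ?_) i s
    have h1 := hbr q p
    rw [h, Pi.zero_apply] at h1
    linarith
  · intro h
    ext ⟨q, p⟩
    simp [hbr, h]
end
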